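/- Let n be a positive integer, 0 < α < n, and let p be a real number with p < (n+α)/(n-α). Then there is no positive continuous function u : ℝⁿ → ℝ satisfying u(x) = ∫_{ℝⁿ} |x−y|^{−(n−α)} u(y)^p dy for every x ∈ ℝⁿ. -/

import Mathlib

open MeasureTheory

/-- The ambient Euclidean space. -/
abbrev ESp (n : ℕ) := EuclideanSpace ℝ (Fin n)

/-- Hypotheses collected: `u` is a regular solution with kernel exponent `m`. -/
structure IsSol (n : ℕ) (m p : ℝ) (u : ESp n → ℝ) : Prop where
  hn : 0 < n
  m0 : 0 < m
  mn : m < n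
  cont : Continuous u
  pos : ∀ x, 0 < u x
  eqn : ∀ x, u x = ∫ y : ESp n, ‖x - y‖ ^ (-m) * u y ^ p

namespace IsSol

variable {n : ℕ} {m p : ℝ} {u : ESp n → ℝ}

theorem nontriv (h : IsSol n m p u) : Nontrivial (ESp n) := by
  have : Nonempty (Fin n) := ⟨⟨0, h.hn⟩⟩
  infer_instance

theorem integrable (h : IsSol n m p u) (x : ESp n) :
    Integrable (fun y : ESp n => ‖x - y‖ ^ (-m) * u y ^ p) := by
  by_contra hc
  have h1 := h.eqn x
  rw [integral_undef hc] at h1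
  exact (h.pos x).ne' h1

theorem integrand_nonneg (h : IsSol n m p u) (x y : ESp n) :
    0 ≤ ‖x - y‖ ^ (-m) * u y ^ p :=
  mul_nonneg (Real.rpow_nonneg (norm_nonneg _) _) (Real.rpow_nonneg (h.pos y).le _)

theorem lower (h : IsSol n m p u) (x : ESp n) (s : Set (ESp n)) (hs : MeasurableSet s)
    (hfin : volume s ≠ ⊤) (c : ℝ) (hc : ∀ y ∈ s, x ≠ y → c ≤ ‖x - y‖ ^ (-m) * u y ^ p) :
    c * volume.real s ≤ u x := by
  have := h.nontriv
  have hv : volume.real (s \ {x}) = volume.real s := by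
    rw [Measure.real, Measure.real, measure_sdiff_null (measure_singleton x)]
  have h1 := setIntegral_ge_of_const_le_real (hs.diff (measurableSet_singleton x))
    (ne_top_of_le_ne_top hfin (measure_mono Set.sdiff_subset))
    (fun y hy => hc y hy.1 (fun hxy => hy.2 hxy.symm)) (h.integrable x).integrableOn
  rw [hv] at h1
  rw [h.eqn x]
  refine h1.trans ?_
  exact setIntegral_le_integral (h.integrable x) (Filter.Eventually.of_forall (h.integrand_nonneg x))

theorem upow_cont (h : IsSol n m p u) : Continuous (fun y => u y ^ p) :=
  h.cont.rpow_const (fun y => Or.inl (h.pos y).ne')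

/-- local integrability of the kernel -/
theorem kernel_int (h : IsSol n m p u) (R : ℝ) :
    IntegrableOn (fun z : ESp n => ‖z‖ ^ (-m)) (Metric.ball 0 R) := by
  obtain ⟨c, hc0, hc⟩ : ∃ c : ℝ, 0 < c ∧ ∀ y ∈ Metric.closedBall (0 : ESp n) R, c ≤ u y ^ p := by
    have hcomp : IsCompact (Metric.closedBall (0 : ESp n) R) := isCompact_closedBall _ _
    rcases (Metric.closedBall (0 : ESp n) R).eq_empty_or_nonempty with he | hne
    · exact ⟨1, one_pos, by simp [he]⟩
    · obtain ⟨z, hz, hmin⟩ := hcomp.exists_isMinOn hne h.upow_cont.continuousOn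
      exact ⟨u z ^ p, Real.rpow_pos_of_pos (h.pos z) _, fun y hy => hmin hy⟩
  have h1 := ((h.integrable 0).const_mul c⁻¹).integrableOn (s := Metric.ball 0 R)
  refine Integrable.mono' h1 ?_ ?_
  · exact (measurable_norm.pow_const (-m)).aestronglyMeasurable
  · refine (ae_restrict_iff' measurableSet_ball).2 (Filter.Eventually.of_forall fun y hy => ?_)
    have := hc y (Metric.ball_subset_closedBall hy)
    rw [zero_sub, norm_neg, Real.norm_of_nonneg (Real.rpow_nonneg (norm_nonneg _) _)]
    have hk : 0 ≤ ‖y‖ ^ (-m) := Real.rpow_nonneg (norm_nonneg _) _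
    rw [inv_mul_eq_div, le_div_iff₀ hc0]
    exact mul_le_mul_of_nonneg_left this hk

/-- annulus volume -/
theorem ann_vol (h : IsSol n m p u) : ∃ ω : ℝ, 0 < ω ∧ ∀ R : ℝ, 0 < R →
    volume.real (Metric.ball (0 : ESp n) (2 * R) \ Metric.ball 0 R) ≥ ω * R ^ (n : ℝ) ∧
    volume.real (Metric.ball (0 : ESp n) R) = ω * R ^ (n : ℝ) := by
  have := h.nontriv
  refine ⟨volume.real (Metric.ball (0 : ESp n) 1), ?_, fun R hR => ?_⟩
  · exact ENNReal.toReal_pos (Metric.measure_ball_pos _ _ one_pos).ne' measure_ball_lt_top.ne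
  · have hb : ∀ r : ℝ, 0 < r → volume.real (Metric.ball (0 : ESp n) r)
        = volume.real (Metric.ball (0 : ESp n) 1) * r ^ (n : ℝ) := by
      intro r hr
      rw [Measure.real, Measure.addHaar_ball _ _ hr.le, ENNReal.toReal_mul,
        ENNReal.toReal_ofReal (by positivity), finrank_euclideanSpace_fin, Real.rpow_natCast, mul_comm]
      rfl
    refine ⟨?_, hb R hR⟩
    rw [measureReal_sdiff (Metric.ball_subset_ball (by linarith)) measurableSet_ball, hb _ hR,
      hb _ (by linarith), Real.mul_rpow (by norm_num) hR.le]
    have h2 : (2 : ℝ) ≤ 2 ^ (n : ℝ) := by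
      rw [Real.rpow_natCast]
      exact le_self_pow₀ (by norm_num) h.hn.ne'
    have h3 : 0 ≤ volume.real (Metric.ball (0 : ESp n) 1) * R ^ (n : ℝ) := by positivity
    nlinarith

/-- one bootstrap step -/
theorem boot (h : IsSol n m p u) (hp : 0 < p) (a c : ℝ) (ha : 0 ≤ a) (hc : 0 < c)
    (hl : ∀ z : ESp n, 1 ≤ ‖z‖ → c * ‖z‖ ^ (-a) ≤ u z) :
    ∃ c' : ℝ, 0 < c' ∧ ∀ x : ESp n, ∀ R : ℝ, 1 ≤ R → ‖x‖ ≤ R →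
      c' * R ^ (-(p * a - (n - m))) ≤ u x := by
  obtain ⟨ω, hω, hvol⟩ := h.ann_vol
  refine ⟨3 ^ (-m) * (c ^ p * 2 ^ (-(p * a))) * ω, by positivity, fun x R hR hxR => ?_⟩
  have hR0 : 0 < R := by linarith
  have key := h.lower x (Metric.ball (0 : ESp n) (2 * R) \ Metric.ball 0 R)
    (measurableSet_ball.diff measurableSet_ball)
    (ne_top_of_le_ne_top measure_ball_lt_top.ne (measure_mono Set.sdiff_subset))
    ((3 * R) ^ (-m) * (c * (2 * R) ^ (-a)) ^ p) ?_
  · refine le_trans ?_ key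
    have h1 := (hvol R hR0).1
    calc _ = ((3 * R) ^ (-m) * (c * (2 * R) ^ (-a)) ^ p) * (ω * R ^ (n : ℝ)) := by
          rw [Real.mul_rpow (by norm_num) hR0.le, Real.mul_rpow hc.le (by positivity),
            ← Real.rpow_mul (by positivity), Real.mul_rpow (by norm_num) hR0.le,
            show -(p * a - (n - m)) = -m + (-a * p) + n by ring, Real.rpow_add hR0,
            Real.rpow_add hR0, show -(p * a) = -a * p by ring]
          ring
      _ ≤ _ := by
          refine mul_le_mul_of_nonneg_left h1 (by positivity)
  · intro y hy hxy
    simp only [Set.mem_sdiff, Metric.mem_ball, dist_zero_right, not_lt] at hy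
    obtain ⟨hy2, hy1⟩ := hy
    have hpos : 0 < ‖x - y‖ := norm_pos_iff.2 (sub_ne_zero.2 hxy)
    have h3 : ‖x - y‖ ≤ 3 * R := (norm_sub_le x y).trans (by linarith)
    refine mul_le_mul (Real.rpow_le_rpow_of_nonpos hpos h3 (by linarith [h.m0])) ?_ (by positivity)
      (by positivity)
    refine Real.rpow_le_rpow (by positivity) ?_ hp.le
    refine le_trans ?_ (hl y (by linarith))
    refine mul_le_mul_of_nonneg_left ?_ hc.le
    exact Real.rpow_le_rpow_of_nonpos (by linarith) hy2.le (by linarith)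

end IsSol

namespace IsSol

variable {n : ℕ} {m p : ℝ} {u : ESp n → ℝ}

theorem no_const_lower (h : IsSol n m p u) (hp : 0 < p) (c : ℝ) (hc : 0 < c)
    (hl : ∀ z : ESp n, 1 ≤ ‖z‖ → c ≤ u z) : False := by
  obtain ⟨c', hc', hb⟩ := h.boot hp 0 c le_rfl hc (by simpa using hl)
  have hα : 0 < (n : ℝ) - m := sub_pos.2 h.mn
  have ht : Filter.Tendsto (fun R : ℝ => c' * R ^ ((n : ℝ) - m)) Filter.atTop Filter.atTop :=
    (tendsto_rpow_atTop hα).const_mul_atTop hc'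
  obtain ⟨R, hR1, hR2⟩ := ((ht.eventually_gt_atTop (u 0)).and (Filter.eventually_ge_atTop 1)).exists
  have := hb 0 R hR2 (by simpa using by linarith)
  simp only [mul_zero, zero_sub, neg_neg] at this
  linarith

theorem no_lower (h : IsSol n m p u) (hp : 0 < p) (a₀ c : ℝ) (ha : 0 ≤ a₀) (hc : 0 < c)
    (hlt : p * a₀ - (n - m) < a₀)
    (hl : ∀ z : ESp n, 1 ≤ ‖z‖ → c * ‖z‖ ^ (-a₀) ≤ u z) : False := by
  have hα : 0 < (n : ℝ) - m := sub_pos.2 h.mn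
  set d : ℝ := min (a₀ - (p * a₀ - (n - m))) (n - m) with hd
  have hd0 : 0 < d := lt_min (by linarith) hα
  have hd1 : d ≤ a₀ - (p * a₀ - (n - m)) := min_le_left _ _
  have hd2 : d ≤ n - m := min_le_right _ _
  have key : ∀ k : ℕ, ∃ a c : ℝ, 0 ≤ a ∧ a ≤ max (a₀ - k * d) 0 ∧ 0 < c ∧
      ∀ z : ESp n, 1 ≤ ‖z‖ → c * ‖z‖ ^ (-a) ≤ u z := by
    intro k
    induction k with
    | zero => exact ⟨a₀, c, ha, by simp, hc, hl⟩
    | succ k ih =>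
      obtain ⟨a, c, ha0, hak, hc, hl⟩ := ih
      obtain ⟨c', hc', hb⟩ := h.boot hp a c ha0 hc hl
      refine ⟨max (p * a - (n - m)) 0, c', le_max_right _ _, ?_, hc', fun z hz => ?_⟩
      · have haa : a ≤ a₀ := hak.trans (max_le (by nlinarith [mul_nonneg (Nat.cast_nonneg (α := ℝ) k) hd0.le]) ha)
        have hstep : p * a - (n - m) ≤ a - d := by
          rcases le_total p 1 with h1 | h1 <;> nlinarith
        refine max_le ?_ (le_max_right _ _)
        rcases le_total a 0 with h0 | h0
        · refine le_trans ?_ (le_max_right _ _)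
          have : a = 0 := le_antisymm h0 ha0
          subst this
          linarith
        · rcases le_total (a₀ - k * d) 0 with h2 | h2
          · rw [max_eq_right h2] at hak
            refine le_trans ?_ (le_max_right _ _)
            linarith
          · rw [max_eq_left h2] at hak
            refine le_trans ?_ (le_max_left _ _)
            push_cast
            linarith
      · refine le_trans ?_ (hb z ‖z‖ hz le_rfl)
        refine mul_le_mul_of_nonneg_left ?_ hc'.le
        exact Real.rpow_le_rpow_of_exponent_le hz (neg_le_neg (le_max_left _ _))
  obtain ⟨k, hk⟩ := exists_nat_gt (a₀ / d)
  obtain ⟨a, c, ha0, hak, hc, hl⟩ := key k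
  rw [div_lt_iff₀ hd0] at hk
  rw [max_eq_right (by linarith)] at hak
  have : a = 0 := le_antisymm hak ha0
  subst this
  exact h.no_const_lower hp c hc (by simpa using hl)

/-- The case `0 < p ≤ 1`. -/
theorem no_small (h : IsSol n m p u) (hp : 0 < p) (hp1 : p ≤ 1) : False := by
  have hα : 0 < (n : ℝ) - m := sub_pos.2 h.mn
  obtain ⟨ω, hω, hvol⟩ := h.ann_vol
  obtain ⟨z₀, hz, hmin⟩ := (isCompact_closedBall (0 : ESp n) 1).exists_isMinOn
    ⟨0, by simp⟩ h.upow_cont.continuousOn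
  have hz0 : 0 < u z₀ ^ p := Real.rpow_pos_of_pos (h.pos z₀) _
  refine h.no_lower hp m (2 ^ (-m) * u z₀ ^ p * ω) h.m0.le (by positivity)
    (by nlinarith [h.m0]) fun z hz1 => ?_
  have key := h.lower z (Metric.ball 0 1) measurableSet_ball measure_ball_lt_top.ne
    ((2 * ‖z‖) ^ (-m) * u z₀ ^ p) fun y hy hzy => ?_
  · rw [(hvol 1 one_pos).2, Real.mul_rpow (by norm_num) (by linarith)] at key
    simp only [Real.one_rpow, mul_one] at key
    linarith
  · have hpos : 0 < ‖z - y‖ := norm_pos_iff.2 (sub_ne_zero.2 hzy)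
    have hy' : ‖y‖ < 1 := by simpa using hy
    refine mul_le_mul (Real.rpow_le_rpow_of_nonpos hpos
      ((norm_sub_le z y).trans (by linarith)) (by linarith [h.m0]))
      (hmin (Metric.ball_subset_closedBall hy)) hz0.le (by positivity)

/-- scaling bound for the kernel mass -/
theorem kernel_mass (h : IsSol n m p u) : ∃ C : ℝ, 0 ≤ C ∧ ∀ R : ℝ, 0 < R →
    ∫⁻ z in Metric.ball (0 : ESp n) R, ENNReal.ofReal (‖z‖ ^ (-m))
      ≤ ENNReal.ofReal (C * R ^ ((n : ℝ) - m)) := by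
  refine ⟨∫ z in Metric.ball (0 : ESp n) 1, ‖z‖ ^ (-m),
    integral_nonneg fun z => Real.rpow_nonneg (norm_nonneg _) _, fun R hR => ?_⟩
  rw [← ofReal_integral_eq_lintegral_ofReal (h.kernel_int R)
    (Filter.Eventually.of_forall fun z => Real.rpow_nonneg (norm_nonneg _) _)]
  refine ENNReal.ofReal_le_ofReal (le_of_eq ?_)
  have h1 := Measure.setIntegral_comp_smul (volume : Measure (ESp n))
    (fun z : ESp n => ‖z‖ ^ (-m)) (Metric.ball (0 : ESp n) 1) hR.ne'
  rw [smul_ball hR.ne', smul_zero, mul_one, Real.norm_of_nonneg hR.le,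
    finrank_euclideanSpace_fin] at h1
  have h2 : ∀ z : ESp n, ‖R • z‖ ^ (-m) = R ^ (-m) * ‖z‖ ^ (-m) := fun z => by
    rw [norm_smul, Real.norm_of_nonneg hR.le, Real.mul_rpow hR.le (norm_nonneg _)]
  simp only [h2] at h1
  rw [integral_const_mul, abs_of_nonneg (by positivity), smul_eq_mul] at h1
  rw [sub_eq_add_neg, Real.rpow_add hR, Real.rpow_natCast]
  have hRn : R ^ n ≠ 0 := by positivity
  field_simp at h1
  linarith

set_option maxHeartbeats 1000000 in
/-- The case `p ≤ 0`. -/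
theorem no_nonpos (h : IsSol n m p u) (hp : p ≤ 0) : False := by
  have := h.nontriv
  have hα : 0 < (n : ℝ) - m := sub_pos.2 h.mn
  obtain ⟨ω, hω, hvol⟩ := h.ann_vol
  obtain ⟨C, hC, hmass⟩ := h.kernel_mass
  -- bound for the mean of the kernel over balls
  have hker : ∃ D : ℝ, 0 < D ∧ ∀ R : ℝ, 0 < R → ∀ y : ESp n, y ≠ 0 →
      ∫⁻ x in Metric.ball (0 : ESp n) R, ENNReal.ofReal (‖x - y‖ ^ (-m))
        ≤ ENNReal.ofReal (D * R ^ (n : ℝ) * ‖y‖ ^ (-m)) := by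
    refine ⟨C * 3 ^ ((n : ℝ) - m) * 2 ^ m + ω * 2 ^ m, by positivity, fun R hR y hy => ?_⟩
    have hy0 : 0 < ‖y‖ := norm_pos_iff.2 hy
    rcases le_total ‖y‖ (2 * R) with hyR | hyR
    · have h1 : ∫⁻ x in Metric.ball (0 : ESp n) R, ENNReal.ofReal (‖x - y‖ ^ (-m))
          ≤ ∫⁻ z in Metric.ball (0 : ESp n) (3 * R), ENNReal.ofReal (‖z‖ ^ (-m)) := by
        rw [← lintegral_indicator measurableSet_ball, ← lintegral_indicator measurableSet_ball,
          ← lintegral_sub_right_eq_self ((Metric.ball (0 : ESp n) (3 * R)).indicator _) y]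
        refine lintegral_mono fun x => ?_
        by_cases hx : x ∈ Metric.ball (0 : ESp n) R
        · rw [Set.indicator_of_mem hx, Set.indicator_of_mem]
          rw [mem_ball_zero_iff] at hx ⊢
          exact (norm_sub_le x y).trans_lt (by linarith)
        · rw [Set.indicator_of_notMem hx]
          exact zero_le
      refine h1.trans ((hmass _ (by linarith)).trans (ENNReal.ofReal_le_ofReal ?_))
      have h2 : R ^ (-m) ≤ 2 ^ m * ‖y‖ ^ (-m) := by
        have := Real.rpow_le_rpow_of_nonpos hy0 hyR (by linarith [h.m0] : -m ≤ 0)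
        rw [Real.mul_rpow (by norm_num) hR.le, Real.rpow_neg (by norm_num : (0:ℝ) ≤ 2)] at this
        have h2m : (0:ℝ) < 2 ^ m := by positivity
        rwa [inv_mul_le_iff₀ h2m] at this
      rw [Real.mul_rpow (by norm_num) hR.le]
      calc C * (3 ^ ((n : ℝ) - m) * R ^ ((n : ℝ) - m))
          = C * 3 ^ ((n : ℝ) - m) * R ^ (n : ℝ) * R ^ (-m) := by
            rw [sub_eq_add_neg (n : ℝ) m, Real.rpow_add hR]; ring
        _ ≤ C * 3 ^ ((n : ℝ) - m) * R ^ (n : ℝ) * (2 ^ m * ‖y‖ ^ (-m)) := by gcongr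
        _ ≤ _ := by
            have : 0 ≤ ω * 2 ^ m * R ^ (n : ℝ) * ‖y‖ ^ (-m) := by positivity
            linarith
    · have h1 : ∫⁻ x in Metric.ball (0 : ESp n) R, ENNReal.ofReal (‖x - y‖ ^ (-m))
          ≤ ∫⁻ x in Metric.ball (0 : ESp n) R, ENNReal.ofReal (2 ^ m * ‖y‖ ^ (-m)) := by
        refine setLIntegral_mono measurable_const fun x hx => ENNReal.ofReal_le_ofReal ?_
        rw [mem_ball_zero_iff] at hx
        have h2 : 2⁻¹ * ‖y‖ ≤ ‖x - y‖ := by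
          have := norm_sub_norm_le y x
          rw [norm_sub_rev y x] at this
          linarith
        have := Real.rpow_le_rpow_of_nonpos (by positivity) h2 (by linarith [h.m0] : -m ≤ 0)
        rwa [Real.mul_rpow (by norm_num) hy0.le, Real.inv_rpow (by norm_num),
          Real.rpow_neg (by norm_num : (0:ℝ) ≤ 2), inv_inv] at this
      refine h1.trans ?_
      rw [setLIntegral_const, ← ofReal_measureReal measure_ball_lt_top.ne, (hvol R hR).2,
        ← ENNReal.ofReal_mul (by positivity)]
      refine ENNReal.ofReal_le_ofReal ?_
      have : 0 ≤ C * 3 ^ ((n : ℝ) - m) * 2 ^ m * R ^ (n : ℝ) * ‖y‖ ^ (-m) := by positivity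
      linarith
  obtain ⟨D, hD, hker⟩ := hker
  -- mean of u over balls is bounded
  have hul : ∀ x, ENNReal.ofReal (u x)
      = ∫⁻ y : ESp n, ENNReal.ofReal (‖x - y‖ ^ (-m)) * ENNReal.ofReal (u y ^ p) := by
    intro x
    rw [h.eqn x, ofReal_integral_eq_lintegral_ofReal (h.integrable x)
      (Filter.Eventually.of_forall (h.integrand_nonneg x))]
    refine lintegral_congr fun y => ENNReal.ofReal_mul (Real.rpow_nonneg (norm_nonneg _) _)
  have hmeasp : Measurable fun y => ENNReal.ofReal (u y ^ p) := h.upow_cont.measurable.ennreal_ofReal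
  have hmean : ∀ R : ℝ, 0 < R → ∫⁻ x in Metric.ball (0 : ESp n) R, ENNReal.ofReal (u x)
      ≤ ENNReal.ofReal (D * R ^ (n : ℝ) * u 0) := by
    intro R hR
    simp_rw [hul]
    rw [lintegral_lintegral_swap]
    · rw [ENNReal.ofReal_mul (by positivity), hul 0,
        ← lintegral_const_mul _ (by fun_prop)]
      refine lintegral_mono_ae ?_
      have h0 : ∀ᵐ y : ESp n, y ≠ 0 := by
        rw [ae_iff]; simp
      filter_upwards [h0] with y hy
      rw [lintegral_mul_const _ (by fun_prop), ← mul_assoc]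
      gcongr
      rw [← ENNReal.ofReal_mul (by positivity), zero_sub, norm_neg]
      exact hker R hR y hy
    · exact (((measurable_fst.sub measurable_snd).norm.pow_const (-m)).ennreal_ofReal.mul
        (hmeasp.comp measurable_snd)).aemeasurable
  -- Chebyshev
  set A : ℝ := 2 * (D * u 0 / ω) with hA
  have hu0 := h.pos 0
  have hA0 : 0 < A := by positivity
  have hcheb : ∀ R : ℝ, 1 ≤ R → A ^ p * R ^ (-m) * (ω * R ^ (n : ℝ) / 2) ≤ u 0 := by
    intro R hR1
    have hR : 0 < R := by linarith
    have h1 := mul_meas_ge_le_lintegral (μ := volume.restrict (Metric.ball (0 : ESp n) R))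
      (h.cont.measurable.ennreal_ofReal) (ENNReal.ofReal A)
    have hset : {x : ESp n | ENNReal.ofReal A ≤ ENNReal.ofReal (u x)} = {x | A ≤ u x} := by
      ext x; simp [ENNReal.ofReal_le_ofReal_iff (h.pos x).le]
    have hms : MeasurableSet {x : ESp n | A ≤ u x} := measurableSet_le measurable_const h.cont.measurable
    rw [hset, Measure.restrict_apply hms] at h1
    have h2 := h1.trans (hmean R hR)
    have hfin : volume ({x : ESp n | A ≤ u x} ∩ Metric.ball 0 R) ≠ ⊤ :=
      ne_top_of_le_ne_top measure_ball_lt_top.ne (measure_mono Set.inter_subset_right)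
    rw [← ofReal_measureReal hfin, ← ENNReal.ofReal_mul hA0.le,
      ENNReal.ofReal_le_ofReal_iff (by positivity)] at h2
    have h3 : volume.real ({x : ESp n | A ≤ u x} ∩ Metric.ball 0 R) ≤ ω * R ^ (n : ℝ) / 2 := by
      have h4 : D * R ^ (n : ℝ) * u 0 = A * (ω * R ^ (n : ℝ) / 2) := by
        rw [hA]; field_simp
      rw [h4] at h2
      exact le_of_mul_le_mul_left h2 hA0
    have h5 : ω * R ^ (n : ℝ) / 2 ≤ volume.real (Metric.ball (0 : ESp n) R \ ({x : ESp n | A ≤ u x} ∩ Metric.ball 0 R)) := by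
      rw [measureReal_sdiff Set.inter_subset_right (hms.inter measurableSet_ball), (hvol R hR).2]
      linarith
    have h6 := h.lower 0 (Metric.ball (0 : ESp n) R \ ({x : ESp n | A ≤ u x} ∩ Metric.ball 0 R))
      (measurableSet_ball.diff (hms.inter measurableSet_ball))
      (ne_top_of_le_ne_top measure_ball_lt_top.ne (measure_mono Set.sdiff_subset))
      (R ^ (-m) * A ^ p) fun y hy h0y => ?_
    · refine le_trans ?_ h6
      rw [mul_comm (R ^ (-m))]
      exact mul_le_mul_of_nonneg_left h5 (by positivity)
    · obtain ⟨hyb, hyn⟩ := hy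
      have hyA : u y < A := by
        by_contra hc
        exact hyn ⟨not_lt.1 hc, hyb⟩
      rw [mem_ball_zero_iff] at hyb
      have hy0 : 0 < ‖y‖ := norm_pos_iff.2 (Ne.symm h0y)
      rw [zero_sub, norm_neg]
      exact mul_le_mul (Real.rpow_le_rpow_of_nonpos hy0 hyb.le (by linarith [h.m0]))
        (Real.rpow_le_rpow_of_nonpos (h.pos y) hyA.le hp) (by positivity) (by positivity)
  have ht : Filter.Tendsto (fun R : ℝ => (A ^ p * ω / 2) * R ^ ((n : ℝ) - m)) Filter.atTop Filter.atTop :=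
    (tendsto_rpow_atTop hα).const_mul_atTop (by positivity)
  obtain ⟨R, hR1, hR2⟩ := ((ht.eventually_gt_atTop (u 0)).and (Filter.eventually_ge_atTop 1)).exists
  have h7 := hcheb R hR2
  rw [sub_eq_add_neg, Real.rpow_add (by linarith)] at hR1
  linarith

end IsSol

/-- inversion about the sphere of radius `l` -/
noncomputable def sInv {n : ℕ} (l : ℝ) (y : ESp n) : ESp n := (l / ‖y‖) ^ 2 • y

/-- Kelvin transform of `u` -/
noncomputable def kelv {n : ℕ} (m : ℝ) (u : ESp n → ℝ) (l : ℝ) (y : ESp n) : ℝ :=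
  (l / ‖y‖) ^ m * u (sInv l y)

/-- the punctured ball -/
def pBall (n : ℕ) (l : ℝ) : Set (ESp n) := {y | y ≠ 0 ∧ ‖y‖ < l}

section Inv
variable {n : ℕ} {l : ℝ}

theorem sInv_eq (l : ℝ) : (sInv l : ESp n → ESp n) = EuclideanGeometry.inversion 0 l := by
  funext y
  simp [sInv, EuclideanGeometry.inversion_def]

theorem sInv_sInv (hl : 0 < l) (y : ESp n) : sInv l (sInv l y) = y := by
  rw [sInv_eq]; exact EuclideanGeometry.inversion_inversion 0 hl.ne' y

theorem norm_sInv (y : ESp n) (hy : y ≠ 0) : ‖sInv l y‖ = l ^ 2 / ‖y‖ := by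
  have : ‖y‖ ≠ 0 := norm_ne_zero_iff.2 hy
  rw [sInv, norm_smul, Real.norm_of_nonneg (by positivity)]
  field_simp

theorem dist_sInv (x y : ESp n) (hx : x ≠ 0) (hy : y ≠ 0) :
    ‖sInv l x - sInv l y‖ = (l / ‖x‖) * ((l / ‖y‖) * ‖x - y‖) := by
  have h1 := EuclideanGeometry.dist_inversion_inversion hx hy l
  rw [← sInv_eq, dist_zero_right, dist_zero_right, dist_eq_norm, dist_eq_norm] at h1
  rw [h1]
  ring

theorem sInv_ne (hl : 0 < l) (y : ESp n) (hy : y ≠ 0) : sInv l y ≠ 0 := by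
  have := norm_pos_iff.2 hy
  rw [← norm_pos_iff, norm_sInv y hy]
  positivity

theorem dist_sInv' (hl : 0 < l) (x y : ESp n) (hx : x ≠ 0) (hy : y ≠ 0) :
    ‖x - sInv l y‖ = (l / ‖y‖) * ((l / ‖x‖)⁻¹ * ‖sInv l x - y‖) := by
  have h1 := dist_sInv (l := l) (sInv l x) y (sInv_ne hl x hx) hy
  rw [sInv_sInv hl, norm_sInv x hx] at h1
  have := norm_pos_iff.2 hx
  rw [h1]
  field_simp

theorem measurableSet_pBall (l : ℝ) : MeasurableSet (pBall n l) := by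
  have : pBall n l = {0}ᶜ ∩ Metric.ball 0 l := by
    ext y; simp [pBall]
  rw [this]
  exact (measurableSet_singleton _).compl.inter measurableSet_ball

theorem sInv_image (hl : 0 < l) : Set.image (sInv l) (pBall n l) = (Metric.closedBall 0 l)ᶜ := by
  ext z
  simp only [Set.mem_image, Set.mem_compl_iff, mem_closedBall_zero_iff, not_le]
  constructor
  · rintro ⟨y, ⟨hy0, hyl⟩, rfl⟩
    have := norm_pos_iff.2 hy0
    rw [norm_sInv y hy0, lt_div_iff₀ this]
    nlinarith
  · intro hz
    have hz0 : z ≠ 0 := norm_pos_iff.1 (hl.trans hz)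
    refine ⟨sInv l z, ⟨sInv_ne hl z hz0, ?_⟩, sInv_sInv hl z⟩
    rw [norm_sInv z hz0, div_lt_iff₀ (hl.trans hz)]
    nlinarith

theorem cov (hn : 0 < n) (hl : 0 < l) (g : ESp n → ℝ) (hg : Integrable g) :
    IntegrableOn (fun y => (l / ‖y‖) ^ (2 * n) * g (sInv l y)) (pBall n l) ∧
    ∫ y, g y = ∫ y in pBall n l, g y + (l / ‖y‖) ^ (2 * n) * g (sInv l y) := by
  have : Nonempty (Fin n) := ⟨⟨0, hn⟩⟩
  let f' : ESp n → ESp n →L[ℝ] ESp n := fun x =>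
    (l / dist x 0) ^ 2 • ((ℝ ∙ (x - 0))ᗮ.reflection : ESp n →L[ℝ] ESp n)
  have hf' : ∀ x ∈ pBall n l, HasFDerivWithinAt (sInv l) (f' x) (pBall n l) x := by
    intro x hx
    rw [sInv_eq]
    exact (EuclideanGeometry.hasFDerivAt_inversion hx.1).hasFDerivWithinAt
  have hinj : Set.InjOn (sInv l) (pBall n l) := fun x _ y _ hxy => by
    rw [← sInv_sInv hl x, hxy, sInv_sInv hl]
  have hdet : ∀ x, |(f' x).det| = (l / ‖x‖) ^ (2 * n) := by
    intro x
    have h1 : (f' x).det = ((l / dist x 0) ^ 2) ^ n * (-1) ^ (Module.finrank ℝ (ℝ ∙ (x - 0))ᗮᗮ) := by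
      rw [← Submodule.det_reflection]
      simp only [f', ContinuousLinearMap.det]
      erw [LinearMap.det_smul]
      rw [finrank_euclideanSpace_fin]
      rfl
    rw [h1, abs_mul, abs_pow, abs_pow (-1 : ℝ), abs_neg, abs_one, one_pow, mul_one, dist_zero_right,
      abs_of_nonneg (sq_nonneg _), ← pow_mul]
  have hI := integrableOn_image_iff_integrableOn_abs_det_fderiv_smul volume
    (measurableSet_pBall l) hf' hinj g
  have hE := integral_image_eq_integral_abs_det_fderiv_smul volume
    (measurableSet_pBall l) hf' hinj g
  simp only [hdet, smul_eq_mul] at hI hE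
  rw [sInv_image hl] at hI hE
  have hint := hI.1 hg.integrableOn
  refine ⟨hint, ?_⟩
  rw [integral_add hg.integrableOn hint, ← hE,
    ← integral_add_compl (Metric.isClosed_closedBall (x := (0 : ESp n)) (ε := l)).measurableSet hg]
  congr 1
  refine setIntegral_congr_set ?_
  have h0 : ∀ᵐ y : ESp n, y ≠ 0 := by
    rw [ae_iff]; simp
  have h1 : ∀ᵐ y : ESp n, y ∉ Metric.sphere (0 : ESp n) l := by
    rw [ae_iff]
    simp only [not_not]
    exact Measure.addHaar_sphere volume (0 : ESp n) l
  filter_upwards [h0, h1] with y hy hy1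
  rw [mem_sphere_zero_iff_norm] at hy1
  refine propext ?_
  change y ∈ Metric.closedBall 0 l ↔ (y ≠ 0 ∧ ‖y‖ < l)
  rw [mem_closedBall_zero_iff]
  exact ⟨fun h => ⟨hy, lt_of_le_of_ne h hy1⟩, fun h => h.2.le⟩

theorem kernel_lt (hl : 0 < l) (x y : ESp n) (hx : x ∈ pBall n l) (hy : y ∈ pBall n l) :
    ‖x - y‖ < (l / ‖x‖)⁻¹ * ‖sInv l x - y‖ := by
  obtain ⟨hx0, hxl⟩ := hx
  obtain ⟨hy0, hyl⟩ := hy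
  have hxp := norm_pos_iff.2 hx0
  have hyp := norm_pos_iff.2 hy0
  refine lt_of_pow_lt_pow_left₀ 2 (by positivity) ?_
  rw [mul_pow, norm_sub_sq_real, norm_sub_sq_real, norm_sInv x hx0, sInv, real_inner_smul_left]
  have key : 0 < (l ^ 2 - ‖x‖ ^ 2) * (l ^ 2 - ‖y‖ ^ 2) := by
    apply mul_pos <;> nlinarith
  have : ((l / ‖x‖)⁻¹ ^ 2 * ((l ^ 2 / ‖x‖) ^ 2 - 2 * ((l / ‖x‖) ^ 2 * inner ℝ x y) + ‖y‖ ^ 2))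
      = (‖x‖ ^ 2 - 2 * inner ℝ x y + ‖y‖ ^ 2) + (l ^ 2 - ‖x‖ ^ 2) * (l ^ 2 - ‖y‖ ^ 2) / l ^ 2 := by
    field_simp
    ring
  rw [this]
  have : 0 < (l ^ 2 - ‖x‖ ^ 2) * (l ^ 2 - ‖y‖ ^ 2) / l ^ 2 := by positivity
  linarith

end Inv

namespace IsSol

variable {n : ℕ} {m p : ℝ} {u : ESp n → ℝ}

theorem rep (h : IsSol n m p u) {l : ℝ} (hl : 0 < l) (x : ESp n) (hx : x ∈ pBall n l) :
    IntegrableOn (fun y => (‖x - y‖ ^ (-m) - ((l / ‖x‖)⁻¹ * ‖sInv l x - y‖) ^ (-m)) *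
      ((l / ‖y‖) ^ (2 * (n : ℝ) - m) * u (sInv l y) ^ p - u y ^ p)) (pBall n l) ∧
    kelv m u l x - u x = ∫ y in pBall n l,
      (‖x - y‖ ^ (-m) - ((l / ‖x‖)⁻¹ * ‖sInv l x - y‖) ^ (-m)) *
      ((l / ‖y‖) ^ (2 * (n : ℝ) - m) * u (sInv l y) ^ p - u y ^ p) := by
  have hx0 : x ≠ 0 := hx.1
  have hxp := norm_pos_iff.2 hx0
  obtain ⟨i1, e1⟩ := cov h.hn hl _ (h.integrable x)
  obtain ⟨i2, e2⟩ := cov h.hn hl _ (h.integrable (sInv l x))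
  have j1 := ((h.integrable x).integrableOn (s := pBall n l)).add i1
  have j2 := (((h.integrable (sInv l x)).integrableOn (s := pBall n l)).add i2).const_mul
    ((l / ‖x‖) ^ m)
  rw [← h.eqn] at e1 e2
  have hpt : ∀ y ∈ pBall n l,
      (l / ‖x‖) ^ m * (‖sInv l x - y‖ ^ (-m) * u y ^ p +
        (l / ‖y‖) ^ (2 * n) * (‖sInv l x - sInv l y‖ ^ (-m) * u (sInv l y) ^ p)) -
      (‖x - y‖ ^ (-m) * u y ^ p +
        (l / ‖y‖) ^ (2 * n) * (‖x - sInv l y‖ ^ (-m) * u (sInv l y) ^ p)) =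
      (‖x - y‖ ^ (-m) - ((l / ‖x‖)⁻¹ * ‖sInv l x - y‖) ^ (-m)) *
      ((l / ‖y‖) ^ (2 * (n : ℝ) - m) * u (sInv l y) ^ p - u y ^ p) := by
    intro y hy
    have hyp := norm_pos_iff.2 hy.1
    have hA : 0 < l / ‖x‖ := by positivity
    have hB : 0 < l / ‖y‖ := by positivity
    rw [dist_sInv x y hx0 hy.1, dist_sInv' hl x y hx0 hy.1]
    generalize l / ‖x‖ = A at *
    generalize l / ‖y‖ = B at *
    rw [Real.mul_rpow hA.le (by positivity), Real.mul_rpow hB.le (by positivity),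
      Real.mul_rpow hB.le (by positivity), Real.mul_rpow (by positivity) (norm_nonneg _),
      Real.inv_rpow hA.le, Real.rpow_neg hA.le, inv_inv,
      show 2 * (n : ℝ) - m = ((2 * n : ℕ) : ℝ) + (-m) by push_cast; ring, Real.rpow_add hB,
      Real.rpow_natCast]
    have : A ^ m ≠ 0 := (Real.rpow_pos_of_pos hA m).ne'
    field_simp
    ring
  have hJ := j2.sub j1
  constructor
  · refine IntegrableOn.congr_fun hJ (fun y hy => ?_) (measurableSet_pBall l)
    exact hpt y hy
  · rw [← setIntegral_congr_fun (measurableSet_pBall l) hpt]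
    have hs := integral_sub j2 j1
    simp only [Pi.add_apply] at hs
    rw [hs, ← e1, integral_const_mul, ← e2]
    rfl

theorem kernel_small (h : IsSol n m p u) (η : ℝ) (hη : 0 < η) :
    ∃ δ : ENNReal, 0 < δ ∧ ∀ (x : ESp n) (s : Set (ESp n)), MeasurableSet s → volume s < δ →
      IntegrableOn (fun y => ‖x - y‖ ^ (-m)) s ∧ ∫ y in s, ‖x - y‖ ^ (-m) ≤ η := by
  have hfin : ∫⁻ z, (Metric.ball (0 : ESp n) 1).indicator
      (fun z => ENNReal.ofReal (‖z‖ ^ (-m))) z ≠ ⊤ := by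
    obtain ⟨C, hC, hm⟩ := h.kernel_mass
    rw [lintegral_indicator measurableSet_ball]
    exact ne_top_of_le_ne_top ENNReal.ofReal_ne_top (hm 1 one_pos)
  obtain ⟨δ, hδ, hs⟩ := exists_pos_setLIntegral_lt_of_measure_lt hfin
    (ε := ENNReal.ofReal (η / 2)) (by simpa using hη)
  refine ⟨min δ (ENNReal.ofReal (η / 2)), lt_min hδ (by simpa using hη), fun x s hsm hsv => ?_⟩
  have hmeas : Measurable fun y : ESp n => ‖x - y‖ ^ (-m) := by fun_prop
  have hbound : ∫⁻ y in s, ENNReal.ofReal (‖x - y‖ ^ (-m)) ≤ ENNReal.ofReal η := by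
    have hpre : MeasurableSet (Set.preimage (fun z => x - z) s) := (measurable_const.sub measurable_id) hsm
    have hvol : volume (Set.preimage (fun z => x - z) s) = volume s :=
      (Measure.measurePreserving_sub_left volume x).measure_preimage hsm.nullMeasurableSet
    calc ∫⁻ y in s, ENNReal.ofReal (‖x - y‖ ^ (-m))
        = ∫⁻ z in (Set.preimage (fun z => x - z) s), ENNReal.ofReal (‖z‖ ^ (-m)) := by
          rw [← lintegral_indicator hsm, ← lintegral_indicator hpre,
            ← lintegral_sub_left_eq_self _ x]
          refine lintegral_congr fun z => ?_
          by_cases hz : x - z ∈ s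
          · have hz' : z ∈ Set.preimage (fun z => x - z) s := hz
            rw [Set.indicator_of_mem hz, Set.indicator_of_mem hz', sub_sub_cancel]
          · have hz' : z ∉ Set.preimage (fun z => x - z) s := hz
            rw [Set.indicator_of_notMem hz, Set.indicator_of_notMem hz']
      _ ≤ ∫⁻ z in (Set.preimage (fun z => x - z) s), ((Metric.ball (0 : ESp n) 1).indicator
            (fun z => ENNReal.ofReal (‖z‖ ^ (-m))) z + 1) := by
          refine lintegral_mono fun z => ?_
          by_cases hz : z ∈ Metric.ball (0 : ESp n) 1
          · rw [Set.indicator_of_mem hz]; exact le_self_add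
          · rw [Set.indicator_of_notMem hz, zero_add, ENNReal.ofReal_le_one]
            rw [mem_ball_zero_iff, not_lt] at hz
            exact Real.rpow_le_one_of_one_le_of_nonpos hz (by linarith [h.m0])
      _ ≤ ENNReal.ofReal (η / 2) + ENNReal.ofReal (η / 2) := by
          rw [lintegral_add_right _ measurable_const, setLIntegral_one, hvol]
          refine add_le_add (hs _ ?_).le (hsv.trans_le (min_le_right _ _)).le
          rw [hvol]; exact hsv.trans_le (min_le_left _ _)
      _ = ENNReal.ofReal η := by
          rw [← ENNReal.ofReal_add (by linarith) (by linarith), add_halves]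
  have hnn : ∀ y : ESp n, 0 ≤ ‖x - y‖ ^ (-m) := fun y => Real.rpow_nonneg (norm_nonneg _) _
  have hint : IntegrableOn (fun y => ‖x - y‖ ^ (-m)) s := by
    refine ⟨hmeas.aestronglyMeasurable, ?_⟩
    rw [hasFiniteIntegral_iff_ofReal (Filter.Eventually.of_forall hnn)]
    exact hbound.trans_lt ENNReal.ofReal_lt_top
  refine ⟨hint, ?_⟩
  rw [← ofReal_integral_eq_lintegral_ofReal hint (Filter.Eventually.of_forall hnn),
    ENNReal.ofReal_le_ofReal_iff hη.le] at hbound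
  exact hbound

end IsSol

namespace IsSol

variable {n : ℕ} {m p : ℝ} {u : ESp n → ℝ}

theorem kelv_pos (h : IsSol n m p u) {l : ℝ} (hl : 0 < l) (y : ESp n) (hy : y ≠ 0) :
    0 < kelv m u l y := by
  have := norm_pos_iff.2 hy
  have := h.pos (sInv l y)
  unfold kelv
  positivity

theorem F_gt (h : IsSol n m p u) (hcrit : m * p < 2 * n - m) {l : ℝ} (hl : 0 < l) (y : ESp n)
    (hy : y ∈ pBall n l) :
    kelv m u l y ^ p < (l / ‖y‖) ^ (2 * (n : ℝ) - m) * u (sInv l y) ^ p := by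
  have hyp := norm_pos_iff.2 hy.1
  have hu := h.pos (sInv l y)
  have h1 : 1 < l / ‖y‖ := by rw [lt_div_iff₀ hyp]; linarith [hy.2]
  rw [kelv, Real.mul_rpow (by positivity) hu.le, ← Real.rpow_mul (by positivity)]
  exact mul_lt_mul_of_pos_right (Real.rpow_lt_rpow_of_exponent_lt h1 hcrit) (by positivity)

theorem G_gt (h : IsSol n m p u) {l : ℝ} (hl : 0 < l) (x y : ESp n)
    (hx : x ∈ pBall n l) (hy : y ∈ pBall n l) (hxy : y ≠ x) :
    ((l / ‖x‖)⁻¹ * ‖sInv l x - y‖) ^ (-m) < ‖x - y‖ ^ (-m) :=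
  Real.rpow_lt_rpow_of_neg (norm_pos_iff.2 (sub_ne_zero.2 hxy.symm)) (kernel_lt hl x y hx hy)
    (by linarith [h.m0])

theorem ae_ne (h : IsSol n m p u) (x : ESp n) (s : Set (ESp n)) :
    ∀ᵐ y ∂(volume.restrict s), y ≠ x := by
  have := h.nontriv
  refine ae_restrict_of_ae ?_
  rw [ae_iff]; simp

theorem strict (h : IsSol n m p u) (hp : 0 < p) (hcrit : m * p < 2 * n - m) {l : ℝ} (hl : 0 < l)
    (hle : ∀ y ∈ pBall n l, u y ≤ kelv m u l y) (x : ESp n) (hx : x ∈ pBall n l) :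
    u x < kelv m u l x := by
  have := h.nontriv
  obtain ⟨hi, he⟩ := h.rep hl x hx
  have hpos : ∀ y ∈ pBall n l, y ≠ x →
      0 < (‖x - y‖ ^ (-m) - ((l / ‖x‖)⁻¹ * ‖sInv l x - y‖) ^ (-m)) *
      ((l / ‖y‖) ^ (2 * (n : ℝ) - m) * u (sInv l y) ^ p - u y ^ p) := by
    intro y hy hyx
    refine mul_pos (sub_pos.2 (h.G_gt hl x y hx hy hyx)) (sub_pos.2 ?_)
    exact (Real.rpow_le_rpow (h.pos y).le (hle y hy) hp.le).trans_lt (h.F_gt hcrit hl y hy)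
  rw [← sub_pos, he, setIntegral_pos_iff_support_of_nonneg_ae _ hi]
  · have hsub : Metric.ball (0 : ESp n) l \ {0, x} ⊆ Function.support (fun y =>
        (‖x - y‖ ^ (-m) - ((l / ‖x‖)⁻¹ * ‖sInv l x - y‖) ^ (-m)) *
        ((l / ‖y‖) ^ (2 * (n : ℝ) - m) * u (sInv l y) ^ p - u y ^ p)) ∩ pBall n l := by
      intro y hy
      simp only [Set.mem_sdiff, mem_ball_zero_iff, Set.mem_insert_iff, Set.mem_singleton_iff,
        not_or] at hy
      have hyb : y ∈ pBall n l := ⟨hy.2.1, hy.1⟩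
      exact ⟨(hpos y hyb hy.2.2).ne', hyb⟩
    refine lt_of_lt_of_le ?_ (measure_mono hsub)
    rw [measure_sdiff_null ((Set.toFinite {0, x}).measure_zero _)]
    exact Metric.measure_ball_pos _ _ hl
  · filter_upwards [h.ae_ne x (pBall n l), ae_restrict_mem (measurableSet_pBall l)] with y hyx hy
    exact (hpos y hy hyx).le

/-- the bad set -/
def bad (_ : IsSol n m p u) (l : ℝ) : Set (ESp n) := {y | y ∈ pBall n l ∧ kelv m u l y < u y}

theorem bad_meas (h : IsSol n m p u) (l : ℝ) : MeasurableSet (h.bad l) := by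
  have h1 : Measurable (sInv l : ESp n → ESp n) := by
    unfold sInv; fun_prop
  have h2 : Measurable (kelv m u l) := by
    unfold kelv
    have := h.cont.measurable.comp h1
    exact ((measurable_const.div measurable_norm).pow_const m).mul this
  exact (measurableSet_pBall l).inter (measurableSet_lt h2 h.cont.measurable)

theorem rpow_lip {p a b M : ℝ} (hp : 1 ≤ p) (hb : 0 < b) (hba : b ≤ a) (haM : a ≤ M) :
    a ^ p - b ^ p ≤ p * M ^ (p - 1) * (a - b) := by
  have ha : 0 < a := by linarith
  have h1 := one_add_mul_self_le_rpow_one_add (s := b / a - 1) (p := p)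
    (by have : 0 ≤ b / a := by positivity
        linarith) hp
  rw [add_sub_cancel, Real.div_rpow hb.le ha.le, le_div_iff₀ (by positivity)] at h1
  have h2 : a ^ p = a ^ (p - 1) * a := by
    rw [← Real.rpow_add_one ha.ne', sub_add_cancel]
  have h3 : a ^ p - b ^ p ≤ p * a ^ (p - 1) * (a - b) := by
    have h4 : (1 + p * (b / a - 1)) * a ^ p = a ^ p - p * a ^ (p - 1) * (a - b) := by
      rw [h2]; field_simp; ring
    linarith
  refine h3.trans ?_
  have h5 : a ^ (p - 1) ≤ M ^ (p - 1) := Real.rpow_le_rpow ha.le haM (by linarith)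
  have : 0 ≤ a - b := by linarith
  gcongr

theorem narrow (h : IsSol n m p u) (hp : 1 ≤ p) (hcrit : m * p < 2 * n - m) (Λ : ℝ) :
    ∃ δ : ENNReal, 0 < δ ∧ ∀ l : ℝ, 0 < l → l ≤ Λ → volume (h.bad l) < δ → h.bad l = ∅ := by
  obtain ⟨M, hM⟩ : ∃ M : ℝ, ∀ y ∈ Metric.closedBall (0 : ESp n) Λ, u y ≤ M := by
    obtain ⟨M, hM⟩ := (isCompact_closedBall (0 : ESp n) Λ).bddAbove_image h.cont.continuousOn
    exact ⟨M, fun y hy => hM (Set.mem_image_of_mem _ hy)⟩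
  set M' : ℝ := max M 1
  have hM'0 : 0 < M' := lt_max_of_lt_right one_pos
  set L : ℝ := p * M' ^ (p - 1) with hL
  have hL0 : 0 < L := by positivity
  obtain ⟨δ, hδ, hsm⟩ := h.kernel_small (1 / (2 * L)) (by positivity)
  refine ⟨δ, hδ, fun l hl hlΛ hbad => ?_⟩
  by_contra hne
  have hne' : (h.bad l).Nonempty := Set.nonempty_iff_ne_empty.2 hne
  have huM : ∀ y ∈ pBall n l, u y ≤ M' := fun y hy =>
    (hM y (by rw [mem_closedBall_zero_iff]; linarith [hy.2])).trans (le_max_left _ _)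
  set T : Set ℝ := Set.image (fun y => u y - kelv m u l y) (h.bad l)
  have hTne : T.Nonempty := hne'.image _
  have hTb : BddAbove T := by
    refine ⟨M', ?_⟩
    rintro _ ⟨y, hy, rfl⟩
    have := h.kelv_pos hl y hy.1.1
    have := huM y hy.1
    simp only
    linarith
  set S : ℝ := sSup T
  have hS : ∀ y ∈ h.bad l, u y - kelv m u l y ≤ S := fun y hy =>
    le_csSup hTb (Set.mem_image_of_mem _ hy)
  obtain ⟨x₀, hx₀⟩ := hne'
  have hS0 : 0 < S := lt_of_lt_of_le (sub_pos.2 hx₀.2) (hS x₀ hx₀)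
  have hhalf : S ≤ S / 2 := by
    refine csSup_le hTne ?_
    rintro _ ⟨x, hx, rfl⟩
    obtain ⟨hi, he⟩ := h.rep hl x hx.1
    obtain ⟨ki, ke⟩ := hsm x (h.bad l) (h.bad_meas l) hbad
    have hdom : Integrable ((h.bad l).indicator fun y => ‖x - y‖ ^ (-m) * (L * S))
        (volume.restrict (pBall n l)) :=
      ((integrable_indicator_iff (h.bad_meas l)).2 (ki.mul_const (L * S))).integrableOn
    have hmono : u x - kelv m u l x ≤ ∫ y in pBall n l,
        (h.bad l).indicator (fun y => ‖x - y‖ ^ (-m) * (L * S)) y := by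
      rw [← neg_sub, he, ← integral_neg]
      refine integral_mono_ae hi.neg hdom ?_
      filter_upwards [h.ae_ne x (pBall n l), ae_restrict_mem (measurableSet_pBall l)] with y hyx hy
      have hG := h.G_gt hl x y hx.1 hy hyx
      have hF := h.F_gt hcrit hl y hy
      have hk := h.kelv_pos hl y hy.1
      have hx' : x ≠ 0 := hx.1.1
      have hH : 0 ≤ ((l / ‖x‖)⁻¹ * ‖sInv l x - y‖) ^ (-m) := by positivity
      set G := ‖x - y‖ ^ (-m)
      set H := ((l / ‖x‖)⁻¹ * ‖sInv l x - y‖) ^ (-m)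
      set F := (l / ‖y‖) ^ (2 * (n : ℝ) - m) * u (sInv l y) ^ p
      rw [← mul_neg, neg_sub]
      by_cases hyb : y ∈ h.bad l
      · rw [Set.indicator_of_mem hyb]
        have h1 : u y ^ p - F ≤ L * S := by
          have h2 := rpow_lip hp hk hyb.2.le (huM y hy)
          have h3 : L * (u y - kelv m u l y) ≤ L * S := mul_le_mul_of_nonneg_left (hS y hyb) hL0.le
          linarith
        have h4 : 0 ≤ L * S := by positivity
        calc (G - H) * (u y ^ p - F) ≤ (G - H) * (L * S) :=
              mul_le_mul_of_nonneg_left h1 (by linarith)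
          _ ≤ G * (L * S) := mul_le_mul_of_nonneg_right (by linarith) h4
      · rw [Set.indicator_of_notMem hyb]
        have h1 : u y ≤ kelv m u l y := by
          by_contra hc
          exact hyb ⟨hy, not_le.1 hc⟩
        have h2 := Real.rpow_le_rpow (h.pos y).le h1 (by linarith : 0 ≤ p)
        exact mul_nonpos_of_nonneg_of_nonpos (by linarith) (by linarith)
    have hsub : h.bad l ⊆ pBall n l := fun y hy => hy.1
    rw [integral_indicator (h.bad_meas l), Measure.restrict_restrict (h.bad_meas l),
      Set.inter_eq_left.2 hsub, integral_mul_const] at hmono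
    refine hmono.trans ?_
    calc _ ≤ 1 / (2 * L) * (L * S) := mul_le_mul_of_nonneg_right ke (by positivity)
      _ = S / 2 := by field_simp
  linarith

theorem kelv_cont (h : IsSol n m p u) (y : ESp n) (hy : y ≠ 0) {l : ℝ} (hl : 0 < l) :
    ContinuousAt (fun l => kelv m u l y) l := by
  have hyp := norm_pos_iff.2 hy
  unfold kelv sInv
  refine ContinuousAt.mul ?_ ?_
  · refine ContinuousAt.rpow_const (by fun_prop) (Or.inl (by positivity))
  · have : Continuous fun l : ℝ => (l / ‖y‖) ^ 2 • y := by fun_prop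
    exact (h.cont.comp this).continuousAt

theorem moving (h : IsSol n m p u) (hp : 1 ≤ p) (hcrit : m * p < 2 * n - m) (Λ : ℝ)
    (hΛ : 0 ≤ Λ) : ∀ y ∈ pBall n Λ, u y ≤ kelv m u Λ y := by
  have := h.nontriv
  let s : Set ℝ := {l | ∀ y ∈ pBall n l, u y ≤ kelv m u l y}
  suffices hs : Set.Icc 0 Λ ⊆ s from hs ⟨hΛ, le_rfl⟩
  have hclosed : IsClosed (s ∩ Set.Icc 0 Λ) := by
    refine isClosed_of_closure_subset fun l hl => ?_
    have hlI : l ∈ Set.Icc 0 Λ := closure_minimal Set.inter_subset_right isClosed_Icc hl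
    refine ⟨fun y hy => ?_, hlI⟩
    have hl0 : 0 < l := (norm_nonneg y).trans_lt hy.2
    rw [mem_closure_iff_frequently] at hl
    have hev : ∀ᶠ l' in nhds l, ‖y‖ < l' := lt_mem_nhds hy.2
    have hfr : ∃ᶠ l' in nhds l, u y ≤ kelv m u l' y :=
      (hl.and_eventually hev).mono fun l' hl' => hl'.1.1 y ⟨hy.1, hl'.2⟩
    by_contra hc
    have := (h.kelv_cont y hy.1 hl0).eventually (gt_mem_nhds (not_le.1 hc))
    obtain ⟨l', h1, h2⟩ := (hfr.and_eventually this).exists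
    exact absurd h1 (not_le.2 h2)
  refine hclosed.Icc_subset_of_forall_exists_gt ?_ ?_
  · intro y hy
    exact absurd hy.2 (not_lt.2 (norm_nonneg y))
  · rintro l ⟨hls, hl0, hlΛ⟩ r hr
    have hr : l < r := hr
    obtain ⟨δ, hδ, hnar⟩ := h.narrow hp hcrit Λ
    have hconv : Filter.Tendsto (fun l' => volume (h.bad l')) (nhdsWithin l (Set.Ioi l))
        (nhds (volume (∅ : Set (ESp n)))) := by
      refine tendsto_measure_of_ae_tendsto_indicator (nhdsWithin l (Set.Ioi l))
        MeasurableSet.empty h.bad_meas (B := Metric.ball 0 (l + 1)) measurableSet_ball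
        measure_ball_lt_top.ne ?_ ?_
      · have : ∀ᶠ l' in nhdsWithin l (Set.Ioi l), l' < l + 1 :=
          nhdsWithin_le_nhds (gt_mem_nhds (by linarith))
        filter_upwards [this] with l' hl' y hy
        rw [mem_ball_zero_iff]
        exact hy.1.2.trans hl'
      · have h1 : ∀ᵐ y : ESp n, y ∉ Metric.sphere (0 : ESp n) l := by
          rw [ae_iff]
          simp only [not_not]
          exact Measure.addHaar_sphere volume (0 : ESp n) l
        filter_upwards [h1] with y hy
        rw [mem_sphere_zero_iff_norm] at hy
        simp only [Set.mem_empty_iff_false, iff_false]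
        rcases lt_or_gt_of_ne hy with hlt | hgt
        · by_cases hy0 : y = 0
          · exact Filter.Eventually.of_forall fun l' hb => hb.1.1 hy0
          · have hl0' : 0 < l := (norm_nonneg y).trans_lt hlt
            have hst := h.strict (by linarith) hcrit hl0' hls y ⟨hy0, hlt⟩
            have := (h.kelv_cont y hy0 hl0').eventually (lt_mem_nhds hst)
            filter_upwards [nhdsWithin_le_nhds this] with l' hl' hb
            exact lt_asymm hl' hb.2
        · have : ∀ᶠ l' in nhdsWithin l (Set.Ioi l), l' < ‖y‖ :=
            nhdsWithin_le_nhds (gt_mem_nhds hgt)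
          filter_upwards [this] with l' hl' hb
          exact lt_asymm hl' hb.1.2
    rw [measure_empty] at hconv
    have e1 := hconv.eventually (gt_mem_nhds hδ)
    have e2 : ∀ᶠ l' in nhdsWithin l (Set.Ioi l), l' < min r Λ :=
      nhdsWithin_le_nhds (gt_mem_nhds (lt_min hr hlΛ))
    have e3 : ∀ᶠ l' in nhdsWithin l (Set.Ioi l), l < l' := self_mem_nhdsWithin
    obtain ⟨l', h1, h2, h3⟩ := (e1.and (e2.and e3)).exists
    refine ⟨l', fun y hy => ?_, h3, (h2.trans_le (min_le_left _ _)).le⟩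
    have hemp := hnar l' (hl0.trans_lt h3) (h2.trans_le (min_le_right _ _)).le h1
    by_contra hc
    have : y ∈ h.bad l' := ⟨hy, not_le.1 hc⟩
    rw [hemp] at this
    exact this

theorem no_large (h : IsSol n m p u) (hp : 1 ≤ p) (hcrit : m * p < 2 * n - m) : False := by
  have hm := h.m0
  obtain ⟨z₀, hz, hmin⟩ := (isCompact_closedBall (0 : ESp n) 1).exists_isMinOn
    ⟨0, by simp⟩ h.cont.continuousOn
  refine h.no_lower (by linarith) (m / 2) (u z₀) (by linarith) (h.pos z₀) (by linarith)
    fun z hz1 => ?_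
  have hzp : 0 < ‖z‖ := by linarith
  rcases hz1.eq_or_lt with h1 | h1
  · rw [← h1, Real.one_rpow, mul_one]
    exact hmin (by simp [← h1])
  · have hy1 : ‖(‖z‖⁻¹ • z : ESp n)‖ = 1 := by
      rw [norm_smul, norm_inv, norm_norm, inv_mul_cancel₀ hzp.ne']
    have hmov := h.moving hp hcrit (Real.sqrt ‖z‖) (Real.sqrt_nonneg _) (‖z‖⁻¹ • z)
      ⟨norm_pos_iff.1 (by rw [hy1]; exact one_pos), by
        rw [hy1]; exact Real.lt_sqrt_of_sq_lt (by simpa using h1)⟩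
    have hinv : sInv (Real.sqrt ‖z‖) (‖z‖⁻¹ • z) = z := by
      rw [sInv, hy1, div_one, Real.sq_sqrt hzp.le, smul_smul, mul_inv_cancel₀ hzp.ne', one_smul]
    rw [kelv, hinv, hy1, div_one, Real.sqrt_eq_rpow, ← Real.rpow_mul hzp.le] at hmov
    have hmn : u z₀ ≤ u (‖z‖⁻¹ • z) := hmin (by rw [mem_closedBall_zero_iff, hy1])
    rw [Real.rpow_neg hzp.le, ← div_eq_mul_inv, div_le_iff₀ (by positivity),
      show m / 2 = 1 / 2 * m by ring]
    linarith

end IsSol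

/-- For `p < (n+α)/(n-α)` (subcritical), there is no regular (positive continuous)
solution of `u(x) = ∫ |x-y|^{-(n-α)} u(y)^p dy` on `ℝⁿ`. -/
theorem no_regular_solution_subcritical
    (n : ℕ) (hn : 0 < n) (α p : ℝ) (hα0 : 0 < α) (hαn : α < n)
    (hp : p < (n + α) / (n - α)) :
    ¬ ∃ u : EuclideanSpace ℝ (Fin n) → ℝ,
        Continuous u ∧ (∀ x, 0 < u x) ∧
        (∀ x, u x = ∫ y : EuclideanSpace ℝ (Fin n),
          ‖x - y‖ ^ (-((n : ℝ) - α)) * u y ^ p) := by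
  rintro ⟨u, hc, hpos, heq⟩
  have h : IsSol n ((n : ℝ) - α) p u := ⟨hn, by linarith, by linarith, hc, hpos, heq⟩
  rcases le_or_gt p 0 with h0 | h0
  · exact h.no_nonpos h0
  rcases le_or_gt p 1 with h1 | h1
  · exact h.no_small h0 h1
  · refine h.no_large h1.le ?_
    rw [lt_div_iff₀ (by linarith)] at hp
    linarith
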